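/- For the monic Hermite polynomials and any $\rho\in\mathbb{R}$ and $m\ge 0$, the extended Mehler formula $\sum_{n\ge 0}\frac{2^n}{n!}H_{n+m}(\rho)\,H_n(x)\,t^n=(1-t^2)^{-\frac{m+1}{2}}\,e^{\rho^2-\frac{(\rho-xt)^2}{1-t^2}}\,H_m\Big(\frac{\rho-xt}{\sqrt{1-t^2}}\Big)$ holds for $|t|<1$. -/

import Mathlib

open Finset

/-- Monic Hermite polynomials: `x H_n = H_{n+1} + (n/2) H_{n-1}`, `H_0 = 1`, `H_1 = X`. -/
noncomputable def hermiteM : ℕ → Polynomial ℝ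
  | 0 => 1
  | 1 => Polynomial.X
  | (n + 2) => Polynomial.X * hermiteM (n + 1) - Polynomial.C (((n : ℝ) + 1) / 2) * hermiteM n

lemma hs_congr {f g : ℕ → ℝ} {a : ℝ} (h : HasSum f a) (hfg : ∀ n, g n = f n) : HasSum g a := by
  rw [funext hfg]; exact h

noncomputable def hh (n : ℕ) (y : ℝ) : ℝ := (hermiteM n).eval y

noncomputable def cc (n : ℕ) : ℝ := (2 : ℝ) ^ n / (n.factorial : ℝ)

lemma hh_zero (y : ℝ) : hh 0 y = 1 := by simp [hh, hermiteM]

lemma hh_one (y : ℝ) : hh 1 y = y := by simp [hh, hermiteM]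

lemma hh_succ_succ (n : ℕ) (y : ℝ) :
    hh (n + 2) y = y * hh (n + 1) y - ((n : ℝ) + 1) / 2 * hh n y := by
  simp [hh, hermiteM]

lemma hh_succ (n : ℕ) (y : ℝ) :
    hh (n + 1) y = y * hh n y - (n : ℝ) / 2 * hh (n - 1) y := by
  cases n with
  | zero => simp [hh_zero, hh_one]
  | succ n => rw [hh_succ_succ]; push_cast; simp

lemma cc_pos (n : ℕ) : 0 < cc n := by unfold cc; positivity

lemma cc_succ (n : ℕ) : cc (n + 1) * ((n : ℝ) + 1) = 2 * cc n := by
  unfold cc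
  rw [Nat.factorial_succ]
  push_cast
  have : (n.factorial : ℝ) ≠ 0 := by positivity
  field_simp
  ring

lemma growth (y q : ℝ) (hq : 1 < q) : ∃ C : ℝ, ∀ n, cc n * hh n y ^ 2 ≤ C * q ^ n := by
  set e : ℕ → ℝ := fun n => cc n * hh n y ^ 2 with he
  have he0 : ∀ n, 0 ≤ e n := fun n => mul_nonneg (cc_pos n).le (sq_nonneg _)
  set δ := q - 1 with hδ
  have hδ0 : 0 < δ := by linarith
  obtain ⟨N, hN⟩ := exists_nat_gt ((1 + 1 / δ) * y ^ 2 * 2 / δ)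
  have hrec : ∀ n, N ≤ n → e (n + 2) ≤ δ * e (n + 1) + (1 + δ) * e n := by
    intro n hn
    have hnN : (N : ℝ) ≤ n := by exact_mod_cast hn
    have h1 : (1 + 1 / δ) * y ^ 2 * 2 ≤ δ * ((n : ℝ) + 2) := by
      have : (1 + 1 / δ) * y ^ 2 * 2 / δ ≤ (n : ℝ) + 2 := by linarith
      rw [div_le_iff₀ hδ0] at this
      linarith
    have c1 := cc_succ n
    have c2 := cc_succ (n + 1)
    push_cast at c2
    have hsq : hh (n + 2) y ^ 2 ≤ (1 + 1 / δ) * y ^ 2 * hh (n + 1) y ^ 2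
        + (1 + δ) * (((n : ℝ) + 1) / 2) ^ 2 * hh n y ^ 2 := by
      rw [hh_succ_succ]
      generalize hh (n + 1) y = a
      generalize hh n y = b
      have : (1 + 1 / δ) * y ^ 2 * a ^ 2
        + (1 + δ) * (((n : ℝ) + 1) / 2) ^ 2 * b ^ 2 - (y * a - ((n : ℝ) + 1) / 2 * b) ^ 2
        = (y * a + δ * (((n : ℝ) + 1) / 2 * b)) ^ 2 / δ := by
        field_simp
        ring
      have h2 : 0 ≤ (y * a + δ * (((n : ℝ) + 1) / 2 * b)) ^ 2 / δ := by positivity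
      linarith
    have hp : (0 : ℝ) < (n : ℝ) + 2 := by positivity
    have hp1 : (0 : ℝ) < (n : ℝ) + 1 := by positivity
    have c2' : cc (n + 2) = 2 * cc (n + 1) / ((n : ℝ) + 2) := by
      rw [eq_div_iff hp.ne', ← c2]; ring
    have c1' : cc (n + 1) = 2 * cc n / ((n : ℝ) + 1) := by
      rw [eq_div_iff hp1.ne', ← c1]
    calc e (n + 2) ≤ cc (n + 2) * ((1 + 1 / δ) * y ^ 2 * hh (n + 1) y ^ 2
        + (1 + δ) * (((n : ℝ) + 1) / 2) ^ 2 * hh n y ^ 2) :=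
          mul_le_mul_of_nonneg_left hsq (cc_pos _).le
      _ = ((1 + 1 / δ) * y ^ 2 * 2) / ((n : ℝ) + 2) * e (n + 1)
          + (1 + δ) * (((n : ℝ) + 1) / ((n : ℝ) + 2)) * e n := by
          simp only [he]
          rw [mul_add, c2', c1']
          field_simp
      _ ≤ δ * e (n + 1) + (1 + δ) * e n := by
          apply add_le_add
          · apply mul_le_mul_of_nonneg_right _ (he0 _)
            rw [div_le_iff₀ hp]; exact h1
          · apply mul_le_mul_of_nonneg_right _ (he0 _)
            have : ((n : ℝ) + 1) / ((n : ℝ) + 2) ≤ 1 := by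
              rw [div_le_one hp]; linarith
            nlinarith
  refine ⟨∑ i ∈ range (N + 2), e i, ?_⟩
  set C := ∑ i ∈ range (N + 2), e i with hC
  have hC0 : 0 ≤ C := Finset.sum_nonneg fun i _ => he0 i
  have hsmall : ∀ n, n < N + 2 → e n ≤ C * q ^ n := by
    intro n hn
    have h1 : e n ≤ C := Finset.single_le_sum (f := e) (fun i _ => he0 i) (by simpa using hn)
    have h2 : 1 ≤ q ^ n := one_le_pow₀ hq.le
    nlinarith
  intro n
  change e n ≤ C * q ^ n
  induction n using Nat.strong_induction_on with
  | _ n ih =>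
    by_cases hn : n < N + 2
    · exact hsmall n hn
    · obtain ⟨k, rfl⟩ : ∃ k, n = k + 2 := ⟨n - 2, by omega⟩
      have a1 := ih (k + 1) (by omega)
      have a2 := ih k (by omega)
      have a3 := hrec k (by omega)
      have hCq : 0 ≤ C * q ^ k := by positivity
      calc e (k + 2) ≤ δ * e (k + 1) + (1 + δ) * e k := a3
        _ ≤ δ * (C * q ^ (k + 1)) + (1 + δ) * (C * q ^ k) := by gcongr
        _ = C * q ^ (k + 2) := by rw [hδ]; ring

lemma summable_sq (j : ℕ) (y r : ℝ) (hr0 : 0 ≤ r) (hr : r < 1) :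
    Summable fun n => cc n * hh (n + j) y ^ 2 * r ^ n := by
  have hq : 1 < 2 / (1 + r) := by rw [lt_div_iff₀ (by linarith)]; linarith
  have hqr : 2 / (1 + r) * r < 1 := by
    rw [div_mul_eq_mul_div, div_lt_one (by linarith)]; linarith
  set q := 2 / (1 + r) with hqdef
  have hq0 : 0 < q := by linarith
  obtain ⟨C, hC⟩ := growth y q hq
  have hs := (summable_choose_mul_geometric_of_norm_lt_one (R := ℝ) j (r := q * r)
    (by rw [Real.norm_eq_abs, abs_of_nonneg (by positivity)]; exact hqr)).mul_left
      (C * q ^ j * (j.factorial : ℝ))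
  refine Summable.of_nonneg_of_le (fun n => ?_) (fun n => ?_) hs
  · have := cc_pos n; positivity
  · have h1 := hC (n + j)
    have hfac : ((n + j).factorial : ℝ) = ((n + j).choose j : ℝ) * j.factorial * n.factorial := by
      have := Nat.add_choose_mul_factorial_mul_factorial n j
      rw [← this]; push_cast; ring
    have hc : cc n ≤ cc (n + j) * (((n + j).choose j : ℝ) * j.factorial) := by
      have : cc (n + j) * (((n + j).choose j : ℝ) * j.factorial) = 2 ^ j * cc n := by
        unfold cc
        rw [hfac]
        have hch : ((n + j).choose j : ℝ) ≠ 0 := by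
          have := Nat.choose_pos (Nat.le_add_left j n)
          positivity
        have : (n.factorial : ℝ) ≠ 0 := by positivity
        have : (j.factorial : ℝ) ≠ 0 := by positivity
        field_simp
        ring
      rw [this]
      have h2 : (1 : ℝ) ≤ 2 ^ j := one_le_pow₀ (by norm_num)
      nlinarith [cc_pos n]
    calc cc n * hh (n + j) y ^ 2 * r ^ n
        ≤ cc (n + j) * (((n + j).choose j : ℝ) * j.factorial) * hh (n + j) y ^ 2 * r ^ n := by
          gcongr
      _ = (cc (n + j) * hh (n + j) y ^ 2) * ((((n + j).choose j : ℝ) * j.factorial) * r ^ n) := by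
          ring
      _ ≤ (C * q ^ (n + j)) * ((((n + j).choose j : ℝ) * j.factorial) * r ^ n) := by
          gcongr
      _ = _ := by rw [mul_pow, pow_add]; ring

lemma summable_abs (j k : ℕ) (y x r : ℝ) (hr0 : 0 ≤ r) (hr : r < 1) :
    Summable fun n => cc n * |hh (n + j) y * hh (n + k) x| * r ^ n := by
  refine Summable.of_nonneg_of_le (fun n => ?_) (fun n => ?_)
    ((summable_sq j y r hr0 hr).add (summable_sq k x r hr0 hr))
  · have := cc_pos n; positivity
  · have h := cc_pos n
    rw [← add_mul, ← mul_add]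
    gcongr
    rw [abs_mul, ← sq_abs (hh (n + j) y), ← sq_abs (hh (n + k) x)]
    nlinarith [sq_nonneg (|hh (n + j) y| - |hh (n + k) x|), abs_nonneg (hh (n + j) y),
      abs_nonneg (hh (n + k) x), sq_nonneg (|hh (n + j) y|), sq_nonneg (|hh (n + k) x|)]

noncomputable def SS (j k : ℕ) (y x t : ℝ) : ℝ :=
  ∑' n, cc n * (hh (n + j) y * hh (n + k) x) * t ^ n

lemma hasSum_SS (j k : ℕ) (y x t : ℝ) (ht : |t| < 1) :
    HasSum (fun n => cc n * (hh (n + j) y * hh (n + k) x) * t ^ n) (SS j k y x t) := by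
  apply Summable.hasSum
  apply Summable.of_norm
  refine (summable_abs j k y x |t| (abs_nonneg t) ht).congr fun n => ?_
  rw [Real.norm_eq_abs, abs_mul (_ * _), abs_mul (cc n), abs_of_pos (cc_pos n), abs_pow]

lemma SS_symm (j k : ℕ) (y x t : ℝ) : SS j k y x t = SS k j x y t := by
  unfold SS
  congr 1
  funext n
  ring

lemma shift (g : ℕ → ℝ) (t A : ℝ) (h : HasSum (fun n => cc n * g (n + 1) * t ^ n) A) :
    HasSum (fun n => cc n * ((n : ℝ) / 2 * g n) * t ^ n) (t * A) := by
  have := (hasSum_nat_add_iff (f := fun n => cc n * ((n : ℝ) / 2 * g n) * t ^ n) (g := t * A) 1).1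
    (by
      refine hs_congr (h.mul_left t) fun n => ?_
      have := cc_succ n
      push_cast
      have h2 : cc (n + 1) * (((n : ℝ) + 1) / 2 * g (n + 1)) * t ^ (n + 1)
        = (cc (n + 1) * ((n : ℝ) + 1)) * (1 / 2 * g (n + 1) * t ^ (n + 1)) := by ring
      rw [h2, this]; ring)
  simpa using this

lemma SS_one (j : ℕ) (y x t : ℝ) (ht : |t| < 1) :
    SS j 1 y x t = x * SS j 0 y x t - t * SS (j + 1) 0 y x t := by
  have h1 := hasSum_SS j 1 y x t ht
  have h2 := (hasSum_SS j 0 y x t ht).mul_left x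
  have h3 := shift (fun n => hh (n + j) y * hh (n - 1) x) t (SS (j + 1) 0 y x t) (by
    refine hs_congr (hasSum_SS (j + 1) 0 y x t ht) fun n => ?_
    simp only [Nat.add_sub_cancel, add_zero]
    rw [show n + 1 + j = n + (j + 1) by ring])
  refine h1.unique ?_
  refine hs_congr (h2.sub h3) fun n => ?_
  rw [hh_succ]
  simp only [add_zero]
  ring

lemma SS_rec (m : ℕ) (y x t : ℝ) (ht : |t| < 1) :
    SS (m + 2) 0 y x t = y * SS (m + 1) 0 y x t - ((m : ℝ) + 1) / 2 * SS m 0 y x t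
      - t * SS (m + 1) 1 y x t := by
  have h1 := hasSum_SS (m + 2) 0 y x t ht
  have h2 := (hasSum_SS (m + 1) 0 y x t ht).mul_left y
  have h3 := (hasSum_SS m 0 y x t ht).mul_left (((m : ℝ) + 1) / 2)
  have h4 := shift (fun n => hh (n + m) y * hh n x) t (SS (m + 1) 1 y x t) (by
    refine hs_congr (hasSum_SS (m + 1) 1 y x t ht) fun n => ?_
    rw [show n + 1 + m = n + (m + 1) by ring])
  refine h1.unique ?_
  refine hs_congr ((h2.sub h3).sub h4) fun n => ?_
  rw [show n + (m + 2) = (n + m) + 2 by ring, hh_succ_succ]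
  simp only [add_zero, ← add_assoc]
  push_cast
  ring

lemma one_sub_pos' {t : ℝ} (ht : |t| < 1) : 0 < 1 - t ^ 2 := by
  have := (sq_lt_one_iff_abs_lt_one t).2 ht
  linarith

lemma SS_rec' (m : ℕ) (y x t : ℝ) (ht : |t| < 1) :
    (1 - t ^ 2) * SS (m + 2) 0 y x t
      = (y - x * t) * SS (m + 1) 0 y x t - ((m : ℝ) + 1) / 2 * SS m 0 y x t := by
  have h1 := SS_rec m y x t ht
  rw [SS_one (m + 1) y x t ht] at h1
  linear_combination h1

lemma SS_base (y x t : ℝ) (ht : |t| < 1) :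
    (1 - t ^ 2) * SS 1 0 y x t = (y - x * t) * SS 0 0 y x t := by
  have h1 := SS_one 0 y x t ht
  have h2 := SS_one 0 x y t ht
  rw [SS_symm 0 1 x y, SS_symm 0 0 x y, SS_symm (0 + 1) 0 x y] at h2
  simp only [zero_add] at h1 h2
  rw [h1] at h2
  linear_combination h2

lemma SS_deriv (y x t : ℝ) (ht : |t| < 1) :
    HasDerivAt (fun t => SS 0 0 y x t) (2 * SS 1 1 y x t) t := by
  obtain ⟨r, hr1, hr2⟩ := exists_between ht
  have hr0 : 0 ≤ r := (abs_nonneg t).trans hr1.le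
  have hd : HasSum (fun n : ℕ => cc n * (hh (n + 0) y * hh (n + 0) x) * ((n : ℝ) * t ^ (n - 1)))
      (2 * SS 1 1 y x t) := by
    have := (hasSum_nat_add_iff
      (f := fun n : ℕ => cc n * (hh (n + 0) y * hh (n + 0) x) * ((n : ℝ) * t ^ (n - 1)))
      (g := 2 * SS 1 1 y x t) 1).1 (by
        refine hs_congr ((hasSum_SS 1 1 y x t ht).mul_left 2) fun n => ?_
        have := cc_succ n
        simp only [add_zero, Nat.add_sub_cancel]
        push_cast
        linear_combination (hh (n + 1) y * hh (n + 1) x * t ^ n) * this)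
    simpa using this
  have hu : Summable (fun n : ℕ => cc n * |hh (n + 0) y * hh (n + 0) x| * ((n : ℝ) * r ^ (n - 1))) := by
    rw [← summable_nat_add_iff 1]
    refine ((summable_abs 1 1 y x r hr0 hr2).mul_left 2).congr fun n => ?_
    have := cc_succ n
    simp only [add_zero, Nat.add_sub_cancel]
    push_cast
    linear_combination -(|hh (n + 1) y * hh (n + 1) x| * r ^ n) * this
  have hmem : t ∈ Set.Ioo (-r) r := abs_lt.1 hr1
  rw [← hd.tsum_eq]
  refine hasDerivAt_tsum_of_isPreconnected
    (g := fun n z => cc n * (hh (n + 0) y * hh (n + 0) x) * z ^ n)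
    (g' := fun n z => cc n * (hh (n + 0) y * hh (n + 0) x) * ((n : ℝ) * z ^ (n - 1)))
    hu isOpen_Ioo isPreconnected_Ioo ?_ ?_ hmem (hasSum_SS 0 0 y x t ht).summable hmem
  · intro n z _
    exact (hasDerivAt_pow n z).const_mul _
  · intro n z hz
    have hz' : |z| ≤ r := (abs_lt.2 hz).le
    rw [Real.norm_eq_abs, abs_mul, abs_mul, abs_of_pos (cc_pos n), abs_mul (n : ℝ), abs_pow,
      Nat.abs_cast]
    have := cc_pos n
    gcongr

lemma SS_ode (y x t : ℝ) (ht : |t| < 1) :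
    (1 - t ^ 2) ^ 2 * (2 * SS 1 1 y x t) =
      (t * (1 - t ^ 2) + 2 * (x - y * t) * (y - x * t)) * SS 0 0 y x t := by
  have h1 := SS_one 1 y x t ht
  have h2 := SS_rec' 0 y x t ht
  have h3 := SS_base y x t ht
  norm_num at h1 h2
  rw [h1]
  linear_combination (-2 * t * (1 - t ^ 2)) * h2
    + (2 * x * (1 - t ^ 2) - 2 * t * (y - x * t)) * h3

lemma SS_zero (y x : ℝ) : SS 0 0 y x 0 = 1 := by
  unfold SS
  rw [tsum_eq_single 0]
  · simp [hh_zero, cc]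
  · intro n hn; simp [hn]

lemma SS_mehler (y x t : ℝ) (ht : |t| < 1) :
    SS 0 0 y x t = (Real.sqrt (1 - t ^ 2))⁻¹ *
      Real.exp (y ^ 2 - (y - x * t) ^ 2 / (1 - t ^ 2)) := by
  set φ : ℝ → ℝ := fun t => SS 0 0 y x t * (Real.sqrt (1 - t ^ 2) *
      Real.exp ((y - x * t) ^ 2 / (1 - t ^ 2) - y ^ 2)) with hφ
  have hder : ∀ s ∈ Set.Ioo (-1 : ℝ) 1, HasDerivAt φ 0 s := by
    intro s hs
    have hs' : |s| < 1 := abs_lt.2 hs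
    have hp := one_sub_pos' hs'
    have d0 : HasDerivAt (fun t : ℝ => 1 - t ^ 2) (-(2 * s)) s := by
      simpa using (hasDerivAt_pow 2 s).const_sub 1
    have d1 := d0.sqrt hp.ne'
    have d2 : HasDerivAt (fun t : ℝ => (y - x * t) ^ 2) (2 * (y - x * s) * (-x)) s := by
      have : HasDerivAt (fun t : ℝ => y - x * t) (-x) s := by
        simpa using ((hasDerivAt_id s).const_mul x).const_sub y
      simpa using! this.pow 2
    have d3 := ((d2.div d0 hp.ne').sub_const (y ^ 2)).exp
    have d4 := (SS_deriv y x s hs').mul (d1.mul d3)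
    refine d4.congr_deriv ?_
    have ode := SS_ode y x s hs'
    have hode : 2 * SS 1 1 y x s = (s * (1 - s ^ 2) + 2 * (x - y * s) * (y - x * s))
        * SS 0 0 y x s / (1 - s ^ 2) ^ 2 := by
      rw [eq_div_iff (by positivity), ← ode]; ring
    rw [hode]
    simp only [Pi.div_apply, Pi.mul_apply]
    generalize Real.exp _ = E
    have hsq : Real.sqrt (1 - s ^ 2) ^ 2 = 1 - s ^ 2 := Real.sq_sqrt hp.le
    have hsp : 0 < Real.sqrt (1 - s ^ 2) := Real.sqrt_pos.2 hp
    generalize Real.sqrt (1 - s ^ 2) = w at *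
    rw [← hsq]
    have hs2 : s ^ 2 = 1 - w ^ 2 := by linarith
    field_simp
    rw [show (w^2:ℝ) = 1 - s^2 from hsq]
    ring
  have hc := isOpen_Ioo.is_const_of_deriv_eq_zero isPreconnected_Ioo
    (fun s hs => (hder s hs).differentiableAt.differentiableWithinAt)
    (fun s hs => (hder s hs).deriv) (abs_lt.1 ht) (show (0 : ℝ) ∈ Set.Ioo (-1 : ℝ) 1 by simp)
  have h0 : φ 0 = 1 := by simp [hφ, SS_zero]
  rw [h0] at hc
  simp only [hφ] at hc
  have hsp : 0 < Real.sqrt (1 - t ^ 2) := Real.sqrt_pos.2 (one_sub_pos' ht)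
  rw [← neg_sub ((y - x * t) ^ 2 / (1 - t ^ 2)), Real.exp_neg, ← mul_inv]
  exact eq_inv_of_mul_eq_one_left hc

lemma SS_formula (y x t : ℝ) (ht : |t| < 1) (m : ℕ) :
    SS m 0 y x t = (Real.sqrt (1 - t ^ 2) ^ (m + 1))⁻¹ *
      Real.exp (y ^ 2 - (y - x * t) ^ 2 / (1 - t ^ 2)) *
      hh m ((y - x * t) / Real.sqrt (1 - t ^ 2)) := by
  have hp := one_sub_pos' ht
  have h0 := SS_mehler y x t ht
  have hb := SS_base y x t ht
  have hr := fun m => SS_rec' m y x t ht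
  generalize Real.exp _ = E at *
  have hsq : Real.sqrt (1 - t ^ 2) ^ 2 = 1 - t ^ 2 := Real.sq_sqrt hp.le
  have hsp : 0 < Real.sqrt (1 - t ^ 2) := Real.sqrt_pos.2 hp
  generalize Real.sqrt (1 - t ^ 2) = w at *
  rw [← hsq] at hb
  simp only [← hsq] at hr
  have hw : w ^ 2 ≠ 0 := by positivity
  induction m using Nat.strong_induction_on with
  | _ m ih =>
    match m, ih with
    | 0, _ => rw [h0, hh_zero]; simp
    | 1, _ =>
      rw [hh_one]
      apply mul_left_cancel₀ hw
      rw [hb, h0]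
      field_simp
      ring
    | (m + 2), ih =>
      have i1 := ih (m + 1) (by omega)
      have i0 := ih m (by omega)
      apply mul_left_cancel₀ hw
      rw [hr, i1, i0, hh_succ_succ]
      field_simp
      ring

/-- Extended Mehler formula:
`∑ 2ⁿ/n! H_{n+m}(ρ) H_n(x) tⁿ
  = (1-t²)^{-(m+1)/2} e^{ρ² - (ρ-xt)²/(1-t²)} H_m((ρ-xt)/√(1-t²))` for `|t| < 1`. -/
theorem stmt17 (m : ℕ) (ρ x t : ℝ) (ht : |t| < 1) :
    HasSum (fun n => (2 : ℝ) ^ n / (n.factorial : ℝ) *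
        (hermiteM (n + m)).eval ρ * (hermiteM n).eval x * t ^ n)
      (Real.rpow (1 - t ^ 2) (-(((m : ℝ) + 1) / 2)) *
        Real.exp (ρ ^ 2 - (ρ - x * t) ^ 2 / (1 - t ^ 2)) *
        (hermiteM m).eval ((ρ - x * t) / Real.sqrt (1 - t ^ 2))) := by
  have hp := one_sub_pos' ht
  have h := hasSum_SS m 0 ρ x t ht
  rw [SS_formula ρ x t ht m] at h
  have hpow : Real.rpow (1 - t ^ 2) (-(((m : ℝ) + 1) / 2))
      = (Real.sqrt (1 - t ^ 2) ^ (m + 1))⁻¹ := by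
    change (1 - t ^ 2) ^ (-(((m : ℝ) + 1) / 2)) = _
    rw [Real.rpow_neg hp.le, Real.sqrt_eq_rpow, ← Real.rpow_natCast _ (m + 1), ← Real.rpow_mul hp.le]
    congr 2
    push_cast
    ring
  rw [hpow]
  refine hs_congr h fun n => ?_
  simp only [cc, hh, add_zero]
  ring
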